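/- arXiv:2107.10613 — 3 statements merged into one kernel-verified Lean document; each statement's English description precedes it below -/
import Mathlib

section
/- Let α, β ∈ (0,1) be irrational and let (X_α, σ_α), (X_β, σ_β) be the one-sided Sturmian subshifts. Every eventual conjugacy h : X_α → X_β is a conjugacy, i.e. satisfies h ∘ σ_α = σ_β ∘ h. -/
noncomputable section

open Set

/-! ### Sturmian sequences and subshifts -/

/-- The Sturmian coding of a real number `t`: `false` (the symbol `0`) if the fractional
part of `t` lies in `[0, 1 - α)`, and `true` (the symbol `1`) if it lies in `[1 - α, 1)`. -/
def sturmianCode (α t : ℝ) : Bool := decide (1 - α ≤ Int.fract t)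

/-- The one-sided Sturmian sequence with parameter `α` and starting point `t`,
i.e. `i ↦ I_α (R_α^i t)`. -/
def sturmianSeqN (α t : ℝ) : ℕ → Bool := fun i => sturmianCode α (t + i * α)

/-- The one-sided Sturmian subshift `X_α`. -/
def sturmianN (α : ℝ) : Set (ℕ → Bool) := closure {x | ∃ t : ℝ, x = sturmianSeqN α t}

/-- The two-sided Sturmian sequence with parameter `α` and starting point `t`. -/
def sturmianSeqZ (α t : ℝ) : ℤ → Bool := fun i => sturmianCode α (t + i * α)

/-- The two-sided Sturmian subshift `Λ_α`. -/
def sturmianZ (α : ℝ) : Set (ℤ → Bool) := closure {x | ∃ t : ℝ, x = sturmianSeqZ α t}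

/-- The shift on one-sided sequences. -/
def shiftN {A : Type*} (x : ℕ → A) : ℕ → A := fun i => x (i + 1)

/-- The shift on two-sided sequences. -/
def shiftZ {A : Type*} (x : ℤ → A) : ℤ → A := fun i => x (i + 1)

lemma continuous_shiftN {A : Type*} [TopologicalSpace A] :
    Continuous (shiftN (A := A)) := continuous_pi fun i => continuous_apply (i + 1)

lemma continuous_shiftZ {A : Type*} [TopologicalSpace A] :
    Continuous (shiftZ (A := A)) := continuous_pi fun i => continuous_apply (i + 1)

lemma sturmianN_shift_mem {α : ℝ} {x : ℕ → Bool} (hx : x ∈ sturmianN α) :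
    shiftN x ∈ sturmianN α := by
  have h : MapsTo shiftN {x : ℕ → Bool | ∃ t : ℝ, x = sturmianSeqN α t}
      {x : ℕ → Bool | ∃ t : ℝ, x = sturmianSeqN α t} := by
    rintro x ⟨t, rfl⟩
    refine ⟨t + α, ?_⟩
    funext i
    show sturmianCode α (t + (↑(i + 1) : ℝ) * α) = sturmianCode α (t + α + (i : ℝ) * α)
    congr 1
    push_cast
    ring
  exact h.closure continuous_shiftN hx

lemma sturmianZ_shift_mem {α : ℝ} {x : ℤ → Bool} (hx : x ∈ sturmianZ α) :
    shiftZ x ∈ sturmianZ α := by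
  have h : MapsTo shiftZ {x : ℤ → Bool | ∃ t : ℝ, x = sturmianSeqZ α t}
      {x : ℤ → Bool | ∃ t : ℝ, x = sturmianSeqZ α t} := by
    rintro x ⟨t, rfl⟩
    refine ⟨t + α, ?_⟩
    funext i
    show sturmianCode α (t + (↑(i + 1) : ℝ) * α) = sturmianCode α (t + α + (i : ℝ) * α)
    congr 1
    push_cast
    ring
  exact h.closure continuous_shiftZ hx

/-- The shift map `σ_α : X_α → X_α` of the one-sided Sturmian subshift. -/
def sturmianShiftN (α : ℝ) (x : ↥(sturmianN α)) : ↥(sturmianN α) :=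
  ⟨shiftN x.1, sturmianN_shift_mem x.2⟩

/-- The shift map `σ_α : Λ_α → Λ_α` of the two-sided Sturmian subshift. -/
def sturmianShiftZ (α : ℝ) (x : ↥(sturmianZ α)) : ↥(sturmianZ α) :=
  ⟨shiftZ x.1, sturmianZ_shift_mem x.2⟩

/-- The branch point `ω_α` of the one-sided Sturmian subshift (corresponding to `t = α`). -/
def sturmianBranch (α : ℝ) : ℕ → Bool := sturmianSeqN α α

/-- The orbit `orb_α(x) = ⋃_{k,l} σ_α^{-l}(σ_α^k(x))` of a point of `X_α`. -/
def sturmianOrbN (α : ℝ) (x : ℕ → Bool) : Set (ℕ → Bool) :=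
  {y | y ∈ sturmianN α ∧ ∃ k l : ℕ, shiftN^[l] y = shiftN^[k] x}

/-- The forward orbit `orb⁺_α(x) = {σ_α^k(x) : k ∈ ℕ}`. -/
def sturmianOrbPlus (α : ℝ) (x : ℕ → Bool) : Set (ℕ → Bool) :=
  {y | ∃ k : ℕ, y = shiftN^[k] x}

/-- The orbit `{σ^n(x) : n ∈ ℤ}` of a two-sided sequence under the shift:
`σ^n(x) = (i ↦ x (i + n))`. -/
def orbitZ {A : Type*} (x : ℤ → A) : Set (ℤ → A) := {y | ∃ n : ℤ, y = fun i => x (i + n)}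

/-- Equivalence of irrationals: `α ∼ β` iff `β = (aα+b)/(cα+d)` with `ad - bc = ±1`. -/
def IrrationalEquiv (α β : ℝ) : Prop :=
  ∃ a b c d : ℤ, (a * d - b * c = 1 ∨ a * d - b * c = -1) ∧
    β = ((a : ℝ) * α + b) / ((c : ℝ) * α + d)

/-- The subgroup `ℤ + αℤ = {m + nα : m, n ∈ ℤ}` of `ℝ`, as an ordered abelian group with
the order inherited from `ℝ`. -/
def ZplusAZ (α : ℝ) : AddSubgroup ℝ where
  carrier := {x | ∃ m n : ℤ, x = (m : ℝ) + n * α}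
  add_mem' := by
    rintro x y ⟨m, n, rfl⟩ ⟨m', n', rfl⟩
    exact ⟨m + m', n + n', by push_cast; ring⟩
  zero_mem' := ⟨0, 0, by norm_num⟩
  neg_mem' := by
    rintro x ⟨m, n, rfl⟩
    exact ⟨-m, -n, by push_cast; ring⟩

lemma one_mem_ZplusAZ (α : ℝ) : (1 : ℝ) ∈ ZplusAZ α := ⟨1, 0, by norm_num⟩

/-! ### Suspension and flow -/

/-- The relation `(x, s+1) ∼ (σ_α x, s)` generating the suspension of `(Λ_α, σ_α)`. -/
def suspRel (α : ℝ) (p q : ↥(sturmianZ α) × ℝ) : Prop :=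
  ∃ (x : ↥(sturmianZ α)) (s : ℝ), p = (x, s + 1) ∧ q = (sturmianShiftZ α x, s)

/-- The suspension (mapping torus) of the two-sided Sturmian subshift `(Λ_α, σ_α)`:
the quotient of `Λ_α × ℝ` by the equivalence relation generated by `(x,s+1) ∼ (σ_α x, s)`. -/
def Suspension (α : ℝ) : Type := Quot (suspRel α)

instance (α : ℝ) : TopologicalSpace (Suspension α) := by
  unfold Suspension; infer_instance

/-- The flow `φ_{s'}[x,s] = [x, s + s']` on the suspension. -/
def suspFlow (α : ℝ) (s' : ℝ) : Suspension α → Suspension α :=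
  Quot.map (fun p => (p.1, p.2 + s'))
    (by
      rintro p q ⟨x, s, rfl, rfl⟩
      exact ⟨x, s + s', by show (x, s + 1 + s') = (x, s + s' + 1); rw [add_right_comm s 1 s'], rfl⟩)

/-- Flow equivalence of two Sturmian subshifts: a homeomorphism of the suspensions mapping
each flow orbit onto a flow orbit, preserving the forward direction of the flow. -/
def SturmianFlowEquiv (α β : ℝ) : Prop :=
  ∃ h : Suspension α ≃ₜ Suspension β, ∀ u : Suspension α, ∃ c : ℝ → ℝ,
    StrictMono c ∧ Function.Surjective c ∧
      ∀ s : ℝ, h (suspFlow α s u) = suspFlow β (c s) (h u)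

/-! ### Words and pasts -/

/-- Prepend a letter to a one-sided sequence. -/
def consSeq {A : Type*} (a : A) (x : ℕ → A) : ℕ → A := fun i => if i = 0 then a else x (i - 1)

/-- Prepend a finite word (a list) to a one-sided sequence: `μx`. -/
def wordCat {A : Type*} (μ : List A) (x : ℕ → A) : ℕ → A := μ.foldr consSeq x

/-- The set `P_l(x)` of `l`-pasts of `x` relative to a subshift `X`. -/
def past {A : Type*} (X : Set (ℕ → A)) (l : ℕ) (x : ℕ → A) : Set (List A) :=
  {μ | μ.length = l ∧ wordCat μ x ∈ X}

/-- `x` is isolated in `l`-past equivalence in `X`. -/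
def IsolatedInPast {A : Type*} (X : Set (ℕ → A)) (l : ℕ) (x : ℕ → A) : Prop :=
  ∀ y ∈ X, past X l y = past X l x → y = x


lemma shiftN_consSeq {A : Type*} (a : A) (x : ℕ → A) : shiftN (consSeq a x) = x := by
  funext i; simp [shiftN, consSeq]

lemma consSeq_shiftN {A : Type*} (x : ℕ → A) : consSeq (x 0) (shiftN x) = x := by
  funext i; cases i <;> simp [consSeq, shiftN]

lemma shiftN_iterate_apply {A : Type*} (x : ℕ → A) (k i : ℕ) : shiftN^[k] x i = x (i + k) := by
  induction k generalizing x i with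
  | zero => rfl
  | succ k ih =>
    rw [Function.iterate_succ_apply, ih (shiftN x) i]
    show x (i + k + 1) = x (i + (k + 1))
    ring_nf

lemma shiftN_iterate_wordCat {A : Type*} (μ : List A) (x : ℕ → A) :
    shiftN^[μ.length] (wordCat μ x) = x := by
  induction μ with
  | nil => rfl
  | cons a μ ih =>
    show shiftN^[μ.length + 1] (consSeq a (wordCat μ x)) = x
    rw [Function.iterate_succ_apply, shiftN_consSeq, ih]

lemma wordCat_append {A : Type*} (μ ν : List A) (x : ℕ → A) :
    wordCat (μ ++ ν) x = wordCat μ (wordCat ν x) := by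
  simp [wordCat, List.foldr_append]

lemma shiftN_mem_of_image {A : Type*} {X : Set (ℕ → A)} (hX : shiftN '' X = X)
    {x : ℕ → A} (hx : x ∈ X) : shiftN x ∈ X := by
  rw [← hX]; exact ⟨x, hx, rfl⟩

lemma shiftN_iterate_mem_of_image {A : Type*} {X : Set (ℕ → A)} (hX : shiftN '' X = X)
    {x : ℕ → A} (hx : x ∈ X) (k : ℕ) : shiftN^[k] x ∈ X := by
  induction k generalizing x with
  | zero => exact hx
  | succ k ih =>
    rw [Function.iterate_succ_apply]
    exact ih (shiftN_mem_of_image hX hx)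

lemma exists_word_extension {A : Type*} {X : Set (ℕ → A)} (hX : shiftN '' X = X)
    {z : ℕ → A} (hz : z ∈ X) (d : ℕ) : ∃ ν : List A, ν.length = d ∧ wordCat ν z ∈ X := by
  induction d with
  | zero => exact ⟨[], rfl, hz⟩
  | succ d ih =>
    obtain ⟨ν, hlen, hν⟩ := ih
    have : wordCat ν z ∈ shiftN '' X := by rw [hX]; exact hν
    obtain ⟨w, hw, hweq⟩ := this
    refine ⟨w 0 :: ν, by simp [hlen], ?_⟩
    show consSeq (w 0) (wordCat ν z) ∈ X
    rw [← hweq, consSeq_shiftN]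
    exact hw

lemma past_mono {A : Type*} {X : Set (ℕ → A)} (hX : shiftN '' X = X) {m l : ℕ} (hml : m ≤ l)
    {z z' : ℕ → A} (h : past X l z = past X l z') : past X m z = past X m z' := by
  have key : ∀ w w' : ℕ → A, past X l w ⊆ past X l w' → past X m w ⊆ past X m w' := by
    intro w w' hsub μ hμ
    obtain ⟨hlen, hmem⟩ := hμ
    obtain ⟨ν, hνlen, hνmem⟩ := exists_word_extension hX hmem (l - m)
    rw [← wordCat_append] at hνmem
    have hin : ν ++ μ ∈ past X l w := ⟨by simp [hνlen, hlen]; omega, hνmem⟩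
    have hout := hsub hin
    obtain ⟨-, hmem'⟩ := hout
    rw [wordCat_append] at hmem'
    have := shiftN_iterate_mem_of_image hX hmem' ν.length
    rw [shiftN_iterate_wordCat] at this
    exact ⟨hlen, this⟩
  exact subset_antisymm (key z z' h.subset) (key z' z h.symm.subset)

/-- prefix word of length `d` -/
def prefixWord {A : Type*} (x : ℕ → A) (d : ℕ) : List A := (List.range d).map x

lemma wordCat_prefixWord {A : Type*} (x : ℕ → A) (d : ℕ) :
    wordCat (prefixWord x d) (shiftN^[d] x) = x := by
  induction d generalizing x with
  | zero => rfl
  | succ d ih =>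
    have h1 : prefixWord x (d + 1) = x 0 :: prefixWord (shiftN x) d := by
      show (List.range (d+1)).map x = _
      rw [List.range_succ_eq_map, List.map_cons, List.map_map]
      rfl
    rw [h1, Function.iterate_succ_apply]
    show consSeq (x 0) (wordCat (prefixWord (shiftN x) d) (shiftN^[d] (shiftN x))) = x
    rw [ih (shiftN x), consSeq_shiftN]

lemma prefixWord_length {A : Type*} (x : ℕ → A) (d : ℕ) : (prefixWord x d).length = d := by
  simp [prefixWord]

lemma past_wordCat {A : Type*} {X : Set (ℕ → A)} (τ : List A) (z : ℕ → A) (m : ℕ) (μ : List A) :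
    μ ∈ past X m (wordCat τ z) ↔ μ ++ τ ∈ past X (m + τ.length) z := by
  constructor
  · rintro ⟨hlen, hmem⟩
    exact ⟨by simp [hlen], by rwa [wordCat_append]⟩
  · rintro ⟨hlen, hmem⟩
    rw [wordCat_append] at hmem
    refine ⟨?_, hmem⟩
    simp at hlen; omega

/-- Monotonicity of `∼_{k,l}` under the order `⪯`. -/
lemma sim_mono {A : Type*} {X : Set (ℕ → A)} (hX : shiftN '' X = X)
    {k₁ l₁ k₂ l₂ : ℕ} (hk : k₁ ≤ k₂) (hl : l₁ - k₁ ≤ l₂ - k₂) (hkl₁ : k₁ ≤ l₁) (hkl₂ : k₂ ≤ l₂)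
    {x y : ℕ → A}
    (h1 : ∀ i < k₂, x i = y i)
    (h2 : past X l₂ (shiftN^[k₂] x) = past X l₂ (shiftN^[k₂] y)) :
    (∀ i < k₁, x i = y i) ∧ past X l₁ (shiftN^[k₁] x) = past X l₁ (shiftN^[k₁] y) := by
  refine ⟨fun i hi => h1 i (lt_of_lt_of_le hi hk), ?_⟩
  set d := k₂ - k₁ with hd
  have hx : shiftN^[k₁] x = wordCat (prefixWord (shiftN^[k₁] x) d) (shiftN^[k₂] x) := by
    have := wordCat_prefixWord (shiftN^[k₁] x) d
    rw [← Function.iterate_add_apply, show d + k₁ = k₂ by omega] at this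
    exact this.symm
  have hy : shiftN^[k₁] y = wordCat (prefixWord (shiftN^[k₁] y) d) (shiftN^[k₂] y) := by
    have := wordCat_prefixWord (shiftN^[k₁] y) d
    rw [← Function.iterate_add_apply, show d + k₁ = k₂ by omega] at this
    exact this.symm
  have hτ : prefixWord (shiftN^[k₁] x) d = prefixWord (shiftN^[k₁] y) d := by
    unfold prefixWord
    refine List.map_congr_left ?_
    intro j hj
    rw [List.mem_range] at hj
    rw [shiftN_iterate_apply, shiftN_iterate_apply]
    exact h1 (j + k₁) (by omega)
  have hpast : past X (l₁ + d) (shiftN^[k₂] x) = past X (l₁ + d) (shiftN^[k₂] y) :=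
    past_mono hX (by omega) h2
  ext μ
  rw [hx, hy, ← hτ, past_wordCat, past_wordCat, prefixWord_length, hpast]

/-- The Sturmian subshift is invariant: `σ(X_α) = X_α`. -/
lemma sturmianN_shift_image (α : ℝ) : shiftN '' sturmianN α = sturmianN α := by
  apply subset_antisymm
  · rintro y ⟨x, hx, rfl⟩
    exact sturmianN_shift_mem hx
  · have hcompact : IsCompact (sturmianN α) := isClosed_closure.isCompact
    have hcl : IsClosed (shiftN '' sturmianN α) :=
      (hcompact.image continuous_shiftN).isClosed
    have hsub : {x : ℕ → Bool | ∃ t : ℝ, x = sturmianSeqN α t} ⊆ shiftN '' sturmianN α := by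
      rintro x ⟨t, rfl⟩
      refine ⟨sturmianSeqN α (t - α), subset_closure ⟨t - α, rfl⟩, ?_⟩
      funext i
      show sturmianCode α (t - α + (↑(i + 1) : ℝ) * α) = sturmianCode α (t + (i : ℝ) * α)
      congr 1
      push_cast
      ring
    exact closure_minimal hsub hcl

/-! ### The cover of a one-sided subshift -/

/-- The equivalence relation `∼_{k,l}` on a subshift `X`:
`x ∼_{k,l} x'` iff `x_{[0,k)} = x'_{[0,k)}` and `P_l(σ^k x) = P_l(σ^k x')`. -/
def coverSetoid {A : Type*} (X : Set (ℕ → A)) (k l : ℕ) : Setoid ↥X where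
  r x y := (∀ i < k, x.1 i = y.1 i) ∧
    past X l (shiftN^[k] x.1) = past X l (shiftN^[k] y.1)
  iseqv := ⟨fun _ => ⟨fun _ _ => rfl, rfl⟩,
    fun h => ⟨fun i hi => (h.1 i hi).symm, h.2.symm⟩,
    fun h h' => ⟨fun i hi => (h.1 i hi).trans (h'.1 i hi), h.2.trans h'.2⟩⟩

/-- The index set `I = {(k,l) ∈ ℕ × ℕ : k ≤ l}`. -/
def CoverIdx : Type := {p : ℕ × ℕ // p.1 ≤ p.2}

/-- The partial order `⪯` on the index set: `(k₁,l₁) ⪯ (k₂,l₂)` iff `k₁ ≤ k₂` and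
`l₁ - k₁ ≤ l₂ - k₂`. -/
def CoverIdx.le (p q : CoverIdx) : Prop :=
  p.1.1 ≤ q.1.1 ∧ p.1.2 - p.1.1 ≤ q.1.2 - q.1.1

/-- The cover `X̃` of a one-sided subshift `X`: the projective limit of the finite
quotients `X/∼_{k,l}` over the directed set `I`, realised as the set of coherent families
of equivalence classes.  A family is coherent if any representative at an index `q` is also
a representative at every index `p ⪯ q`. -/
def SubshiftCover {A : Type*} (X : Set (ℕ → A)) : Type _ :=
  {f : (p : CoverIdx) → Quotient (coverSetoid X p.1.1 p.1.2) //
    ∀ p q : CoverIdx, CoverIdx.le p q → ∀ x : ↥X,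
      f q = Quotient.mk (coverSetoid X q.1.1 q.1.2) x →
      f p = Quotient.mk (coverSetoid X p.1.1 p.1.2) x}

instance {A : Type*} [TopologicalSpace A] (X : Set (ℕ → A)) :
    TopologicalSpace (SubshiftCover X) := by
  unfold SubshiftCover; infer_instance

/-- The factor map `π : X̃ → X` (with values in the ambient space `A^ℕ`): the `n`-th letter
of `π(xt)` is the `n`-th letter of any `(n+1, n+1)`-representative of `xt`. -/
def coverProj {A : Type*} {X : Set (ℕ → A)} (f : SubshiftCover X) : ℕ → A := fun n =>
  Quotient.lift (fun x : ↥X => x.1 n)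
    (by intro a b h; obtain ⟨h1, -⟩ := h; exact h1 n (Nat.lt_succ_self n))
    (f.1 ⟨(n + 1, n + 1), le_refl _⟩)

/-- The shift `σ̃ : X̃ → X̃` induced on the cover: the `(k,l)`-coordinate of `σ̃(xt)` is the
class of `σ(x)` for a `(k+1, l+1)`-representative `x` of `xt`. -/
def coverShift {A : Type*} {X : Set (ℕ → A)} (hX : shiftN '' X = X)
    (f : SubshiftCover X) : SubshiftCover X :=
  ⟨fun p => Quotient.lift
      (fun x : ↥X => Quotient.mk (coverSetoid X p.1.1 p.1.2)
        ⟨shiftN x.1, shiftN_mem_of_image hX x.2⟩)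
      (by
        intro a b h
        obtain ⟨h1, h2⟩ := h
        apply Quotient.sound
        constructor
        · intro i hi
          exact h1 (i + 1) (Nat.succ_lt_succ hi)
        · show past X p.1.2 (shiftN^[p.1.1] (shiftN a.1)) =
            past X p.1.2 (shiftN^[p.1.1] (shiftN b.1))
          rw [← Function.iterate_succ_apply, ← Function.iterate_succ_apply]
          exact past_mono hX (Nat.le_succ p.1.2) h2)
      (f.1 ⟨(p.1.1 + 1, p.1.2 + 1), Nat.succ_le_succ p.2⟩),
    by
      intro p q hpq y hy
      obtain ⟨x, hx⟩ := Quotient.exists_rep (f.1 ⟨(q.1.1 + 1, q.1.2 + 1), Nat.succ_le_succ q.2⟩)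
      have hq' : f.1 ⟨(p.1.1 + 1, p.1.2 + 1), Nat.succ_le_succ p.2⟩ =
          Quotient.mk (coverSetoid X (p.1.1 + 1) (p.1.2 + 1)) x := by
        refine f.2 _ ⟨(q.1.1 + 1, q.1.2 + 1), Nat.succ_le_succ q.2⟩ ?_ x hx.symm
        refine ⟨Nat.succ_le_succ hpq.1, ?_⟩
        show p.1.2 + 1 - (p.1.1 + 1) ≤ q.1.2 + 1 - (q.1.1 + 1)
        have := hpq.2; omega
      beta_reduce at hy ⊢
      rw [← hx] at hy
      rw [hq']
      obtain ⟨h1, h2⟩ := Quotient.exact hy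
      exact Quotient.sound (sim_mono hX hpq.1 hpq.2 p.2 q.2 h1 h2)⟩

/-- The section `ι : X → X̃`, sending `x` to the family of its own classes. -/
def coverIota {A : Type*} {X : Set (ℕ → A)} (hX : shiftN '' X = X) (x : ↥X) :
    SubshiftCover X :=
  ⟨fun p => Quotient.mk (coverSetoid X p.1.1 p.1.2) x, by
    intro p q hpq y hy
    obtain ⟨h1, h2⟩ := Quotient.exact hy
    exact Quotient.sound (sim_mono hX hpq.1 hpq.2 p.2 q.2 h1 h2)⟩


/-! ### Approximation by forward orbits of irrational rotations -/

lemma exists_nat_mul_sub_int_mem_Ioo {α : ℝ} (hα : Irrational α) (t : ℝ) {a b : ℝ} (hab : a < b) :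
    ∃ (i : ℕ) (m : ℤ), t + i * α - m ∈ Ioo a b := by
  have hd : DenseRange fun n : ℕ => n • (α : AddCircle (1 : ℝ)) :=
    denseRange_zsmul_iff_nsmul.1 (AddCircle.denseRange_zsmul_coe_iff.2 (by simpa using hα))
  let U : Set (AddCircle (1 : ℝ)) := (fun u : ℝ => (u : AddCircle (1 : ℝ))) '' Ioo (a - t) (b - t)
  have hU : IsOpen U := QuotientAddGroup.isOpenMap_coe _ isOpen_Ioo
  obtain ⟨i, u, hu, hui⟩ := hd.exists_mem_open hU ((nonempty_Ioo.2 (by linarith)).image _)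
  obtain ⟨m, hm⟩ := AddCircle.coe_eq_zero_iff (1 : ℝ) |>.1
    (show ((i * α - u : ℝ) : AddCircle (1 : ℝ)) = 0 by
      rw [AddCircle.coe_sub, show (u : AddCircle (1 : ℝ)) = _ from hui, ← nsmul_eq_mul, AddCircle.coe_nsmul, sub_self])
  rw [zsmul_one] at hm
  exact ⟨i, m, by linarith [hu.1], by linarith [hu.2]⟩

/-! ### Codings of points of the circle -/

lemma sturmianCode_of_sub_int_mem {t : ℝ} (α : ℝ) {m : ℤ} (h : t - m ∈ Ico (0 : ℝ) 1) :
    sturmianCode α t = decide (1 - α ≤ t - m) := by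
  have : Int.fract t = t - m := Int.fract_eq_iff.2 ⟨h.1, h.2, m, by ring⟩
  rw [sturmianCode, this]

lemma sturmianCode_add_int (α t : ℝ) (m : ℤ) : sturmianCode α (t + m) = sturmianCode α t := by
  simp [sturmianCode]

lemma sturmianSeqN_add_int (α t : ℝ) (m : ℤ) : sturmianSeqN α (t + m) = sturmianSeqN α t := by
  funext i
  rw [sturmianSeqN, add_right_comm, sturmianCode_add_int]
  rfl

lemma shiftN_iterate_sturmianSeqN (α t : ℝ) (n : ℕ) :
    shiftN^[n] (sturmianSeqN α t) = sturmianSeqN α (t + n * α) := by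
  funext i
  rw [shiftN_iterate_apply]
  simp only [sturmianSeqN]
  push_cast
  ring_nf

lemma sturmianSeqN_mem (α t : ℝ) : sturmianSeqN α t ∈ sturmianN α := subset_closure ⟨t, rfl⟩

/-- A positive angle less than `1` between two points is detected by their codings. -/
lemma sturmianSeqN_ne_add {α : ℝ} (hα : Irrational α) (hαm : α ∈ Ioo (0 : ℝ) 1) (t : ℝ) {d : ℝ}
    (hd : d ∈ Ioo (0 : ℝ) 1) : sturmianSeqN α t ≠ sturmianSeqN α (t + d) := by
  obtain ⟨h0, h1⟩ := hαm
  obtain ⟨d0, d1⟩ := hd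
  intro h
  rcases le_or_gt d α with hdα | hdα
  · obtain ⟨i, m, hi⟩ := exists_nat_mul_sub_int_mem_Ioo hα t
      (show max 0 (1 - α - d) < 1 - α by rw [max_lt_iff]; constructor <;> linarith)
    rw [mem_Ioo, max_lt_iff] at hi
    have := congrFun h i
    rw [sturmianSeqN, sturmianSeqN,
      sturmianCode_of_sub_int_mem α (m := m) ⟨by linarith, by linarith⟩,
      sturmianCode_of_sub_int_mem α (m := m) ⟨by linarith, by linarith⟩,
      decide_eq_decide] at this
    linarith [this.2 (by linarith)]
  · obtain ⟨i, m, hi⟩ := exists_nat_mul_sub_int_mem_Ioo hα t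
      (show 1 - α < min 1 (2 - α - d) by rw [lt_min_iff]; constructor <;> linarith)
    rw [mem_Ioo, lt_min_iff] at hi
    have := congrFun h i
    have hc : ((m + 1 : ℤ) : ℝ) = m + 1 := by push_cast; ring
    rw [sturmianSeqN, sturmianSeqN,
      sturmianCode_of_sub_int_mem α (m := m) ⟨by linarith, by linarith⟩,
      sturmianCode_of_sub_int_mem α (m := m + 1)
        ⟨by rw [hc]; linarith, by rw [hc]; linarith⟩,
      decide_eq_decide, hc] at this
    linarith [this.1 (by linarith)]

lemma exists_int_of_sturmianSeqN_eq {α : ℝ} (hα : Irrational α) (hαm : α ∈ Ioo (0 : ℝ) 1)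
    {t s : ℝ} (h : sturmianSeqN α t = sturmianSeqN α s) : ∃ m : ℤ, s = t + m := by
  refine ⟨⌊s - t⌋, ?_⟩
  by_contra hne
  have hf : Int.fract (s - t) ≠ 0 := fun h0 => hne (by linarith [Int.self_sub_fract (s - t)])
  refine sturmianSeqN_ne_add hα hαm t
    ⟨lt_of_le_of_ne (Int.fract_nonneg _) hf.symm, Int.fract_lt_one _⟩ ?_
  rw [h, ← sturmianSeqN_add_int α (t + Int.fract (s - t)) ⌊s - t⌋, add_assoc, Int.fract_add_floor]
  congr 1
  ring

lemma eventually_sturmianCode_eq {α u : ℝ} (h0 : ∀ m : ℤ, u ≠ m) (h1 : ∀ m : ℤ, u + α ≠ m) :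
    ∀ᶠ s in nhds u, sturmianCode α s = sturmianCode α u := by
  have hlt : (⌊u⌋ : ℝ) < u := lt_of_le_of_ne (Int.floor_le u) (h0 _).symm
  have hu := sturmianCode_of_sub_int_mem (t := u) α (m := ⌊u⌋)
    ⟨by linarith, by linarith [Int.lt_floor_add_one u]⟩
  have key : ∀ᶠ s in nhds u, (1 - α ≤ s - ⌊u⌋ ↔ 1 - α ≤ u - ⌊u⌋) := by
    rcases lt_trichotomy (1 - α + ⌊u⌋) u with h | h | h
    · filter_upwards [lt_mem_nhds h] with s hs
      constructor <;> intro <;> linarith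
    · exact absurd (by push_cast; linarith) (h1 (⌊u⌋ + 1))
    · filter_upwards [gt_mem_nhds h] with s hs
      constructor <;> intro <;> linarith
  filter_upwards [key, lt_mem_nhds hlt, gt_mem_nhds (Int.lt_floor_add_one u)] with s hs hs0 hs1
  rw [hu, sturmianCode_of_sub_int_mem α (m := ⌊u⌋) ⟨by linarith, by linarith⟩,
    decide_eq_decide, hs]

lemma eventually_sturmianCode_eq_right (α u : ℝ) :
    ∀ᶠ s in nhdsWithin u (Ioi u), sturmianCode α s = sturmianCode α u := by
  have hu := sturmianCode_of_sub_int_mem (t := u) α (m := ⌊u⌋)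
    ⟨by linarith [Int.floor_le u], by linarith [Int.lt_floor_add_one u]⟩
  have key : ∀ᶠ s in nhdsWithin u (Ioi u), (1 - α ≤ s - ⌊u⌋ ↔ 1 - α ≤ u - ⌊u⌋) := by
    rcases le_or_gt (1 - α + ⌊u⌋) u with h | h
    · filter_upwards [self_mem_nhdsWithin] with s hs
      rw [mem_Ioi] at hs
      constructor <;> intro <;> linarith
    · filter_upwards [nhdsWithin_le_nhds (gt_mem_nhds h)] with s hs
      constructor <;> intro <;> linarith
  filter_upwards [key, self_mem_nhdsWithin,
    nhdsWithin_le_nhds (gt_mem_nhds (Int.lt_floor_add_one u))] with s hs hs0 hs1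
  rw [mem_Ioi] at hs0
  rw [hu, sturmianCode_of_sub_int_mem α (m := ⌊u⌋)
    ⟨by linarith [Int.floor_le u], by linarith⟩, decide_eq_decide, hs]

lemma tendsto_sturmianSeqN_right (α t : ℝ) :
    Filter.Tendsto (sturmianSeqN α) (nhdsWithin t (Ioi t)) (nhds (sturmianSeqN α t)) := by
  rw [tendsto_pi_nhds]
  intro i
  refine tendsto_nhds_of_eventually_eq ?_
  have hshift : Filter.Tendsto (fun s : ℝ => s + i * α) (nhdsWithin t (Ioi t))
      (nhdsWithin (t + i * α) (Ioi (t + i * α))) := by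
    refine tendsto_nhdsWithin_iff.2 ⟨?_, ?_⟩
    · exact ((continuous_add_const _).tendsto t).mono_left nhdsWithin_le_nhds
    · filter_upwards [self_mem_nhdsWithin] with s hs
      rw [mem_Ioi] at hs ⊢
      linarith
  exact hshift.eventually (eventually_sturmianCode_eq_right α (t + i * α))

/-- Points of the subshift coincide with codings at the coordinates where no discontinuity
of the coding is met. -/
lemma exists_eq_sturmianSeqN_apply {α : ℝ} {x : ℕ → Bool} (hx : x ∈ sturmianN α) :
    ∃ t : ℝ, ∀ i : ℕ, (∀ m : ℤ, t + i * α ≠ m) → (∀ m : ℤ, t + (i + 1 : ℕ) * α ≠ m) →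
      x i = sturmianSeqN α t i := by
  have hsub : {x : ℕ → Bool | ∃ t : ℝ, x = sturmianSeqN α t} ⊆
      sturmianSeqN α '' Icc 0 1 := by
    rintro _ ⟨t, rfl⟩
    refine ⟨Int.fract t, ⟨Int.fract_nonneg t, (Int.fract_lt_one t).le⟩, ?_⟩
    rw [← sturmianSeqN_add_int α (Int.fract t) ⌊t⌋, Int.fract_add_floor]
  obtain ⟨v, hv, hvx⟩ := mem_closure_iff_ultrafilter.1 (closure_mono hsub hx)
  let w := Ultrafilter.ofComapInfPrincipal hv
  have hwI : Icc (0 : ℝ) 1 ∈ w := Ultrafilter.ofComapInfPrincipal_mem hv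
  have hwv : w.map (sturmianSeqN α) = v := Ultrafilter.ofComapInfPrincipal_eq_of_map hv
  obtain ⟨t, -, ht⟩ := isCompact_iff_ultrafilter_le_nhds.1 isCompact_Icc w
    (Filter.le_principal_iff.2 hwI)
  have hwx : Filter.Tendsto (sturmianSeqN α) w (nhds x) := by
    rwa [Filter.Tendsto, ← Ultrafilter.coe_map, hwv]
  refine ⟨t, fun i hi hi' => tendsto_nhds_unique (tendsto_pi_nhds.1 hwx i) ?_⟩
  refine tendsto_nhds_of_eventually_eq (Filter.Eventually.filter_mono ht ?_)
  refine ((continuous_add_const (i * α)).tendsto t).eventually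
    (eventually_sturmianCode_eq hi fun m h => hi' m ?_)
  push_cast
  linarith

/-- The sequences that eventually agree with the coding of a point of `ℤ + αℤ`. -/
def eventualIntegerCodings (α : ℝ) : Set (ℕ → Bool) :=
  {x | ∃ (N : ℕ) (m n : ℤ), ∀ i, N ≤ i → x i = sturmianSeqN α (m + n * α) i}

lemma countable_eventualIntegerCodings (α : ℝ) : (eventualIntegerCodings α).Countable := by
  have : eventualIntegerCodings α = ⋃ (N : ℕ) (m : ℤ) (n : ℤ),
      {x : ℕ → Bool | ∀ i, N ≤ i → x i = sturmianSeqN α (m + n * α) i} := by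
    ext x
    simp [eventualIntegerCodings]
  rw [this]
  refine countable_iUnion fun N => countable_iUnion fun m => countable_iUnion fun n => ?_
  refine countable_of_injective_of_countable_image
    (f := fun (x : ℕ → Bool) (i : Fin N) => x i) ?_ (to_countable _)
  intro x hx y hy hxy
  funext i
  rcases lt_or_ge i N with hi | hi
  · exact congrFun hxy ⟨i, hi⟩
  · rw [hx i hi, hy i hi]

lemma mem_eventualIntegerCodings_of_shift_eq {α : ℝ} {x y : ℕ → Bool} {K : ℕ}
    (hxy : shiftN^[K] x = shiftN^[K] y) (hx : x ∈ eventualIntegerCodings α) :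
    y ∈ eventualIntegerCodings α := by
  obtain ⟨N, m, n, hN⟩ := hx
  refine ⟨N + K, m, n, fun i hi => ?_⟩
  have := congrFun hxy (i - K)
  rw [shiftN_iterate_apply, shiftN_iterate_apply, Nat.sub_add_cancel (by omega)] at this
  rw [← this, hN i (by omega)]

lemma exists_eq_sturmianSeqN_of_notMem {α : ℝ} (hα : Irrational α) {x : ℕ → Bool}
    (hx : x ∈ sturmianN α) (hxC : x ∉ eventualIntegerCodings α) :
    ∃ t : ℝ, x = sturmianSeqN α t := by
  obtain ⟨t, ht⟩ := exists_eq_sturmianSeqN_apply hx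
  refine ⟨t, ?_⟩
  by_cases hG : ∃ (j : ℕ) (m : ℤ), t + j * α = m
  · obtain ⟨j, m, hj⟩ := hG
    have hne : ∀ i : ℕ, j < i → ∀ l : ℤ, t + i * α ≠ l := by
      intro i hi l hl
      refine (hα.intCast_mul (m := (i : ℤ) - j) (by omega)).ne_int (l - m) ?_
      push_cast
      linarith
    refine absurd ⟨j + 1, m, -j, fun i hi => ?_⟩ hxC
    rw [ht i (hne i (by omega)) (hne (i + 1) (by omega)), show t = m + (-j : ℤ) * α by
      push_cast; linarith]
  · push Not at hG
    funext i
    exact ht i (hG i) (hG (i + 1))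

/-- Outside the countable set of eventual codings of points of `ℤ + αℤ`, iterates of the shift
are injective. -/
lemma eq_of_shiftN_iterate_eq {α : ℝ} (hα : Irrational α) (hαm : α ∈ Ioo (0 : ℝ) 1)
    {x y : ℕ → Bool} (hx : x ∈ sturmianN α) (hy : y ∈ sturmianN α)
    (hxC : x ∉ eventualIntegerCodings α) {K : ℕ} (hxy : shiftN^[K] x = shiftN^[K] y) :
    x = y := by
  have hyC : y ∉ eventualIntegerCodings α :=
    fun h => hxC (mem_eventualIntegerCodings_of_shift_eq hxy.symm h)
  obtain ⟨t, rfl⟩ := exists_eq_sturmianSeqN_of_notMem hα hx hxC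
  obtain ⟨s, rfl⟩ := exists_eq_sturmianSeqN_of_notMem hα hy hyC
  rw [shiftN_iterate_sturmianSeqN, shiftN_iterate_sturmianSeqN] at hxy
  obtain ⟨m, hm⟩ := exists_int_of_sturmianSeqN_eq hα hαm hxy
  rw [show s = t + m by linarith, sturmianSeqN_add_int]

/-- The complement of a countable set is dense in a Sturmian subshift. -/
lemma dense_compl_of_countable {α : ℝ} (hα : Irrational α) (hαm : α ∈ Ioo (0 : ℝ) 1)
    {D : Set ↥(sturmianN α)} (hD : D.Countable) : Dense Dᶜ := by
  rw [dense_iff_inter_open]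
  rintro _ ⟨V, hV, rfl⟩ ⟨⟨x, hx⟩, hxV⟩
  obtain ⟨_, htV, t, rfl⟩ := mem_closure_iff.1 hx V hV hxV
  obtain ⟨u, htu, hu⟩ := mem_nhdsGT_iff_exists_Ioo_subset.1
    ((tendsto_sturmianSeqN_right α t).eventually (hV.mem_nhds htV))
  let F : ℝ → ↥(sturmianN α) := fun s => ⟨sturmianSeqN α s, sturmianSeqN_mem α s⟩
  let J := Ioo t (min u (t + 1))
  have hF : InjOn F J := by
    intro r hr s hs hrs
    obtain ⟨m, hm⟩ := exists_int_of_sturmianSeqN_eq hα hαm (congrArg Subtype.val hrs)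
    have hr1 := hr.2.trans_le (min_le_right u (t + 1))
    have hs1 := hs.2.trans_le (min_le_right u (t + 1))
    have h1 : m < 1 := by exact_mod_cast (by linarith [hr.1] : (m : ℝ) < 1)
    have h2 : -1 < m := by exact_mod_cast (by linarith [hs.1] : (-1 : ℝ) < m)
    have h3 : m = 0 := by omega
    rw [hm, h3, Int.cast_zero, add_zero]
  have hJ : ¬ J.Countable := by
    rw [← Cardinal.le_aleph0_iff_set_countable, Cardinal.mk_Ioo_real, not_le]
    · exact Cardinal.aleph0_lt_continuum
    · exact lt_min htu (lt_add_one t)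
  obtain ⟨s, hs, hsD⟩ : ∃ s ∈ J, F s ∉ D := by
    by_contra! hcon
    exact hJ (countable_of_injective_of_countable_image hF
      (hD.mono (image_subset_iff.2 hcon)))
  exact ⟨F s, hu ⟨hs.1, hs.2.trans_le (min_le_left _ _)⟩, hsD⟩

lemma countable_preimage_shiftN {A : Type*} [Countable A] {C : Set (ℕ → A)} (hC : C.Countable) :
    (shiftN ⁻¹' C).Countable := by
  refine ((countable_univ (α := A)).image2 hC consSeq).mono fun x hx => ?_
  exact ⟨x 0, mem_univ _, shiftN x, hx, consSeq_shiftN x⟩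

lemma continuous_sturmianShiftN (α : ℝ) : Continuous (sturmianShiftN α) :=
  (continuous_shiftN.comp continuous_subtype_val).subtype_mk _

/-- Every eventual conjugacy `h : X_α → X_β` between one-sided Sturmian
subshifts is a conjugacy, i.e. satisfies `h ∘ σ_α = σ_β ∘ h`. -/
theorem sturmian_eventual_conjugacy_is_conjugacy (α β : ℝ)
    (hα : Irrational α) (hβ : Irrational β)
    (hαm : α ∈ Set.Ioo (0 : ℝ) 1) (hβm : β ∈ Set.Ioo (0 : ℝ) 1)
    (h : ↥(sturmianN α) ≃ₜ ↥(sturmianN β))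
    (k : ↥(sturmianN α) → ℕ) (k' : ↥(sturmianN β) → ℕ)
    (hk : Continuous k) (hk' : Continuous k')
    (heq : ∀ x : ↥(sturmianN α),
      shiftN^[k x + 1] ((h x : ℕ → Bool)) = shiftN^[k x] ((h (sturmianShiftN α x) : ℕ → Bool)))
    (heq' : ∀ y : ↥(sturmianN β),
      shiftN^[k' y + 1] ((h.symm y : ℕ → Bool))
        = shiftN^[k' y] ((h.symm (sturmianShiftN β y) : ℕ → Bool))) :
    ∀ x : ↥(sturmianN α), h (sturmianShiftN α x) = sturmianShiftN β (h x) := by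
  obtain ⟨K, hK⟩ : ∃ K, ∀ x, k x ≤ K := by
    have : CompactSpace ↥(sturmianN α) :=
      isCompact_iff_compactSpace.1 isClosed_closure.isCompact
    obtain ⟨K, hK⟩ := (isCompact_range hk).bddAbove
    exact ⟨K, fun x => hK (mem_range_self x)⟩
  have hcomm : ∀ x, shiftN^[K] (h (sturmianShiftN α x)).1 =
      shiftN^[K] (sturmianShiftN β (h x)).1 := by
    intro x
    rw [← Nat.sub_add_cancel (hK x), Function.iterate_add_apply, ← heq x,
      Function.iterate_succ_apply, ← Function.iterate_add_apply]
    rfl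
  have hcount : {x | (h (sturmianShiftN α x)).1 ∈ eventualIntegerCodings β}.Countable := by
    have h1 := (countable_eventualIntegerCodings β).preimage
      (Subtype.val_injective.comp h.injective)
    have h2 := countable_preimage_shiftN (h1.image Subtype.val)
    refine (h2.preimage Subtype.val_injective).mono fun x hx => ?_
    exact ⟨sturmianShiftN α x, hx, rfl⟩
  have hclosed : IsClosed {x | h (sturmianShiftN α x) = sturmianShiftN β (h x)} :=
    isClosed_eq (h.continuous.comp (continuous_sturmianShiftN α))
      ((continuous_sturmianShiftN β).comp h.continuous)
  have hsub : {x | (h (sturmianShiftN α x)).1 ∈ eventualIntegerCodings β}ᶜ ⊆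
      {x | h (sturmianShiftN α x) = sturmianShiftN β (h x)} := fun x hx =>
    Subtype.ext (eq_of_shiftN_iterate_eq hβ hβm (Subtype.prop _) (Subtype.prop _) hx (hcomm x))
  intro x
  exact hclosed.closure_subset_iff.2 hsub (dense_compl_of_countable hα hαm hcount x)

end
end

section
/- Let X be a one-sided subshift over a finite alphabet with σ(X) = X, and let X̃ be its cover with factor map π : X̃ → X and induced shift σ̃. If σ^k is injective at x ∈ X (i.e. σ^{-k}(x) is a singleton), then σ̃^k is injective at every x̃ ∈ π^{-1}(x) (i.e. σ̃^{-k}(x̃) is a singleton). In particular, if x has a unique past (σ^k is injective at x for all k ∈ ℕ), then every x̃ ∈ π^{-1}(x) has a unique past. -/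
noncomputable section

open Set

lemma coverProj_apply_of_rep {A : Type*} {X : Set (ℕ → A)} (f : SubshiftCover X)
    (q : CoverIdx) (x : ↥X) (hx : f.1 q = Quotient.mk (coverSetoid X q.1.1 q.1.2) x)
    {i : ℕ} (hi : i < q.1.1) : coverProj f i = x.1 i := by
  have h := f.2 ⟨(i + 1, i + 1), le_refl _⟩ q ⟨hi, by simp⟩ x hx
  simp only [coverProj, h, Quotient.lift_mk]

lemma coverShift_eq_mk_of_rep {A : Type*} {X : Set (ℕ → A)} (hX : shiftN '' X = X)
    (f : SubshiftCover X) (p : CoverIdx) (x : ↥X)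
    (hx : f.1 ⟨(p.1.1 + 1, p.1.2 + 1), Nat.succ_le_succ p.2⟩ =
      Quotient.mk (coverSetoid X (p.1.1 + 1) (p.1.2 + 1)) x) :
    (coverShift hX f).1 p =
      Quotient.mk (coverSetoid X p.1.1 p.1.2) ⟨shiftN x.1, shiftN_mem_of_image hX x.2⟩ := by
  simp only [coverShift, hx, Quotient.lift_mk]

/-- The factor map intertwines the shifts: `π ∘ σ̃ = σ ∘ π`. -/
lemma coverProj_coverShift {A : Type*} {X : Set (ℕ → A)} (hX : shiftN '' X = X)
    (f : SubshiftCover X) : coverProj (coverShift hX f) = shiftN (coverProj f) := by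
  funext i
  obtain ⟨x, hx⟩ := Quotient.exists_rep (f.1 ⟨(i + 1 + 1, i + 1 + 1), le_refl _⟩)
  have h := coverShift_eq_mk_of_rep hX f ⟨(i + 1, i + 1), le_refl _⟩ x hx.symm
  rw [coverProj_apply_of_rep _ _ _ h (Nat.lt_succ_self i)]
  exact (coverProj_apply_of_rep f _ x hx.symm (Nat.lt_succ_self (i + 1))).symm

lemma coverProj_coverShift_iterate {A : Type*} {X : Set (ℕ → A)} (hX : shiftN '' X = X)
    (k : ℕ) (f : SubshiftCover X) :
    coverProj ((coverShift hX)^[k] f) = shiftN^[k] (coverProj f) :=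
  Function.Semiconj.iterate_right (coverProj_coverShift hX) k f

/-- The factor map takes values in the subshift. -/
lemma coverProj_mem {A : Type*} [TopologicalSpace A] [DiscreteTopology A]
    {X : Set (ℕ → A)} (hcl : IsClosed X) (f : SubshiftCover X) : coverProj f ∈ X := by
  let r : ℕ → ↥X := fun n => (f.1 ⟨(n, n), le_refl _⟩).out
  refine hcl.mem_of_tendsto (f := fun n => (r n).1) (b := Filter.atTop) ?_
    (Filter.Eventually.of_forall fun n => (r n).2)
  rw [tendsto_pi_nhds]
  intro i
  refine tendsto_const_nhds.congr' ?_
  filter_upwards [Filter.eventually_gt_atTop i] with n hn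
  exact coverProj_apply_of_rep f ⟨(n, n), le_refl _⟩ (r n) (Quotient.out_eq _).symm hn

/-- A point of the cover is determined by its shift and its first letter. -/
lemma eq_of_coverShift_eq {A : Type*} {X : Set (ℕ → A)} (hX : shiftN '' X = X)
    {f g : SubshiftCover X} (hs : coverShift hX f = coverShift hX g)
    (h0 : coverProj f 0 = coverProj g 0) : f = g := by
  apply Subtype.ext
  funext p
  obtain ⟨⟨m, l⟩, hml : m ≤ l⟩ := p
  let q : CoverIdx := ⟨(m, l + 1), Nat.le_succ_of_le hml⟩
  let q' : CoverIdx := ⟨(m + 1, l + 1 + 1), Nat.succ_le_succ q.2⟩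
  obtain ⟨x, hx⟩ := Quotient.exists_rep (f.1 q')
  obtain ⟨y, hy⟩ := Quotient.exists_rep (g.1 q')
  have hpq : CoverIdx.le ⟨(m, l), hml⟩ q' :=
    ⟨Nat.le_succ m, show l - m ≤ l + 1 + 1 - (m + 1) by omega⟩
  rw [f.2 _ q' hpq x hx.symm, g.2 _ q' hpq y hy.symm]
  have hxy : x.1 0 = y.1 0 := by
    rw [← coverProj_apply_of_rep f q' x hx.symm (Nat.succ_pos m),
      ← coverProj_apply_of_rep g q' y hy.symm (Nat.succ_pos m), h0]
  have h : (coverShift hX f).1 q = (coverShift hX g).1 q := by rw [hs]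
  rw [coverShift_eq_mk_of_rep hX f q x hx.symm, coverShift_eq_mk_of_rep hX g q y hy.symm] at h
  obtain ⟨h1, h2⟩ := Quotient.exact h
  refine Quotient.sound (sim_mono hX (Nat.le_succ m) (l₂ := l + 1) (by omega) hml (by omega)
    ?_ h2)
  rintro (_ | i) hi
  · exact hxy
  · exact h1 i (Nat.lt_of_succ_lt_succ hi)

lemma eq_of_coverShift_iterate_eq {A : Type*} {X : Set (ℕ → A)} (hX : shiftN '' X = X)
    (k : ℕ) {f g : SubshiftCover X} (hs : (coverShift hX)^[k] f = (coverShift hX)^[k] g)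
    (hp : coverProj f = coverProj g) : f = g := by
  induction k generalizing f g with
  | zero => exact hs
  | succ k ih =>
    refine eq_of_coverShift_eq hX (ih hs ?_) (congrFun hp 0)
    rw [coverProj_coverShift, coverProj_coverShift, hp]

/-- Prepending a letter is compatible with the equivalence relations `∼_{k,l}`. -/
lemma consSeq_rel {A : Type*} {X : Set (ℕ → A)} (hX : shiftN '' X = X) (a : A)
    {k l : ℕ} (hkl : k ≤ l) {x y : ↥X} (hx : consSeq a x.1 ∈ X) (hy : consSeq a y.1 ∈ X)
    (h : coverSetoid X k (l + 1) x y) :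
    coverSetoid X k l ⟨consSeq a x.1, hx⟩ ⟨consSeq a y.1, hy⟩ := by
  obtain ⟨h1, h2⟩ := h
  refine sim_mono hX (Nat.le_succ k) (l₂ := l + 1) (by omega) hkl (by omega) ?_ ?_
  · rintro (_ | i) hi
    · rfl
    · exact h1 i (Nat.lt_of_succ_lt_succ hi)
  · rw [Function.iterate_succ_apply, Function.iterate_succ_apply, shiftN_consSeq, shiftN_consSeq]
    exact h2

lemma coverShift_surjective {A : Type*} {X : Set (ℕ → A)} (hX : shiftN '' X = X) :
    Function.Surjective (coverShift hX) := by
  intro f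
  obtain ⟨x₀, hx₀⟩ := Quotient.exists_rep (f.1 ⟨(0, 1), Nat.zero_le 1⟩)
  obtain ⟨w, hw, hwx⟩ : x₀.1 ∈ shiftN '' X := by rw [hX]; exact x₀.2
  set a := w 0
  have ha : consSeq a x₀.1 ∈ X := by rwa [← hwx, consSeq_shiftN]
  let up : CoverIdx → CoverIdx := fun p => ⟨(p.1.1, p.1.2 + 1), Nat.le_succ_of_le p.2⟩
  let r : CoverIdx → ↥X := fun p => (f.1 (up p)).out
  have hr : ∀ p, f.1 (up p) = Quotient.mk _ (r p) := fun p => (Quotient.out_eq _).symm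
  have hmem : ∀ p, consSeq a (r p).1 ∈ X := by
    intro p
    have hle : CoverIdx.le ⟨(0, 1), Nat.zero_le 1⟩ (up p) :=
      ⟨Nat.zero_le _, show 1 - 0 ≤ p.1.2 + 1 - p.1.1 by have := p.2; omega⟩
    obtain ⟨-, h⟩ := Quotient.exact (hx₀.trans (f.2 _ _ hle _ (hr p)))
    have hin : [a] ∈ past X 1 x₀.1 := ⟨rfl, ha⟩
    have hout : [a] ∈ past X 1 (r p).1 := h.subset hin
    exact hout.2
  refine ⟨⟨fun p => Quotient.mk _ ⟨consSeq a (r p).1, hmem p⟩, ?_⟩, ?_⟩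
  · intro p q hpq y hy
    obtain ⟨h1, h2⟩ := Quotient.exact hy
    have hle : CoverIdx.le (up p) (up q) :=
      ⟨hpq.1, show p.1.2 + 1 - p.1.1 ≤ q.1.2 + 1 - q.1.1 by
        have := hpq.2; have := p.2; have := q.2; omega⟩
    have hrel := Quotient.exact ((hr p).symm.trans (f.2 _ _ hle _ (hr q)))
    exact (Quotient.sound (consSeq_rel hX a p.2 (hmem p) (hmem q) hrel)).trans
      (Quotient.sound (sim_mono hX hpq.1 hpq.2 p.2 q.2 h1 h2))
  · apply Subtype.ext
    funext p
    refine (coverShift_eq_mk_of_rep hX _ p _ rfl).trans ?_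
    let p' : CoverIdx := ⟨(p.1.1 + 1, p.1.2 + 1), Nat.succ_le_succ p.2⟩
    have hle : CoverIdx.le p (up p') :=
      ⟨Nat.le_succ _, show p.1.2 - p.1.1 ≤ p.1.2 + 1 + 1 - (p.1.1 + 1) by omega⟩
    refine Eq.trans ?_ (f.2 _ _ hle _ (hr p')).symm
    exact congrArg (Quotient.mk _) (Subtype.ext (shiftN_consSeq a _))

lemma coverShift_fibre_singleton {A : Type*} [TopologicalSpace A] [DiscreteTopology A]
    {X : Set (ℕ → A)} (hcl : IsClosed X) (hX : shiftN '' X = X) (k : ℕ) (f : SubshiftCover X)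
    (h : ∃ y : ℕ → A, {z : ℕ → A | z ∈ X ∧ shiftN^[k] z = coverProj f} = {y}) :
    ∃ g : SubshiftCover X, {z : SubshiftCover X | (coverShift hX)^[k] z = f} = {g} := by
  obtain ⟨y, hy⟩ := h
  have hproj : ∀ z : SubshiftCover X, (coverShift hX)^[k] z = f → coverProj z = y := by
    rintro z rfl
    exact hy.subset ⟨coverProj_mem hcl z, (coverProj_coverShift_iterate hX k z).symm⟩
  obtain ⟨g, hg⟩ := (coverShift_surjective hX).iterate k f
  refine ⟨g, subset_antisymm (fun z hz => ?_) (by rintro z rfl; exact hg)⟩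
  exact eq_of_coverShift_iterate_eq hX k (hz.trans hg.symm)
    ((hproj z hz).trans (hproj g hg).symm)

/-- Let `X` be a one-sided subshift over a finite alphabet with `σ(X) = X` and
cover `(X̃, σ̃)` with factor map `π`.  If `σ^k` is injective at `x ∈ X` (i.e. `σ^{-k}(x)` is a
singleton), then `σ̃^k` is injective at every `xt ∈ π⁻¹(x)`.  In particular, if `x` has a
unique past, then every `xt ∈ π⁻¹(x)` has a unique past. -/
theorem cover_shift_injective_at_fibre (A : Type*) [Fintype A]
    [TopologicalSpace A] [DiscreteTopology A]
    (X : Set (ℕ → A)) (hcl : IsClosed X) (hX : shiftN '' X = X) :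
    (∀ (k : ℕ) (x : ℕ → A), x ∈ X →
      (∃ y : ℕ → A, {z : ℕ → A | z ∈ X ∧ shiftN^[k] z = x} = {y}) →
      ∀ xt : SubshiftCover X, coverProj xt = x →
        ∃ yt : SubshiftCover X, {zt : SubshiftCover X | (coverShift hX)^[k] zt = xt} = {yt}) ∧
    (∀ x : ℕ → A, x ∈ X →
      (∀ k : ℕ, ∃ y : ℕ → A, {z : ℕ → A | z ∈ X ∧ shiftN^[k] z = x} = {y}) →
      ∀ xt : SubshiftCover X, coverProj xt = x →
        ∀ k : ℕ, ∃ yt : SubshiftCover X,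
          {zt : SubshiftCover X | (coverShift hX)^[k] zt = xt} = {yt}) := by
  refine ⟨?_, ?_⟩
  · rintro k x - h xt rfl
    exact coverShift_fibre_singleton hcl hX k xt h
  · rintro x - h xt rfl k
    exact coverShift_fibre_singleton hcl hX k xt (h k)

end
end

section
/- Let α ∈ (0,1) be irrational and X_α the one-sided Sturmian subshift. For any admissible word μ of X_α there is a point x ∈ X_α such that P_{|μ|}(x) = {μ}, i.e. μ is the unique word of length |μ| with μx ∈ X_α. -/
noncomputable section

open Set

/-! ### Rotation codings -/

open Filter Topology

lemma wordCat_apply_of_lt {A : Type*} (μ : List A) (x : ℕ → A) (i : ℕ) (hi : i < μ.length) :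
    wordCat μ x i = μ.get ⟨i, hi⟩ := by
  induction μ generalizing i with
  | nil => simp at hi
  | cons a μ ih =>
    cases i with
    | zero => rfl
    | succ i => exact ih i (by simpa using hi)

lemma wordCat_apply_add_length {A : Type*} (μ : List A) (x : ℕ → A) (i : ℕ) :
    wordCat μ x (i + μ.length) = x i := by
  rw [← shiftN_iterate_apply (wordCat μ x), shiftN_iterate_wordCat]

lemma prefixWord_eq_of_get {A : Type*} {x : ℕ → A} {μ : List A}
    (h : ∀ (i : ℕ) (hi : i < μ.length), x i = μ.get ⟨i, hi⟩) : prefixWord x μ.length = μ := by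
  refine List.ext_get (prefixWord_length x _) fun i h₁ h₂ => ?_
  rw [← h i h₂]
  simp [prefixWord]

/-- Every point of the Sturmian subshift agrees with a coded orbit on any given prefix. -/
lemma exists_sturmianSeqN_eq_prefix {α : ℝ} {z : ℕ → Bool} (hz : z ∈ sturmianN α) (N : ℕ) :
    ∃ t : ℝ, ∀ i < N, sturmianSeqN α t i = z i := by
  have hU : (Iio N).pi (fun i => {z i}) ∈ 𝓝 z :=
    set_pi_mem_nhds (finite_Iio N) fun i _ => by simp
  obtain ⟨_, hx, t, rfl⟩ := mem_closure_iff_nhds.1 hz _ hU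
  exact ⟨t, fun i hi => hx i hi⟩

lemma sturmianCode_of_mem_Ico {α t : ℝ} {n : ℤ} (ht : t ∈ Ico (n : ℝ) (n + 1)) :
    sturmianCode α t = decide (n + 1 - α ≤ t) := by
  have hfl : ⌊t⌋ = n := Int.floor_eq_iff.2 ht
  unfold sturmianCode
  rw [Int.fract, hfl]
  congr 1
  apply propext
  constructor <;> intro h <;> linarith

lemma sturmianCode_eq_true {α t : ℝ} (hα : α < 1) {n : ℤ} (h₁ : n - α ≤ t) (h₂ : t < n) :
    sturmianCode α t = true := by
  rw [sturmianCode_of_mem_Ico (n := n - 1) ⟨by push_cast; linarith, by push_cast; linarith⟩]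
  simp only [decide_eq_true_eq]
  push_cast
  linarith

lemma sturmianCode_eq_false {α t : ℝ} (hα : 0 < α) {n : ℤ} (h₁ : n ≤ t) (h₂ : t < n + 1 - α) :
    sturmianCode α t = false := by
  rw [sturmianCode_of_mem_Ico (n := n) ⟨h₁, by linarith⟩]
  exact decide_eq_false (not_le.2 h₂)

lemma sturmianCode_sub_intCast (α t : ℝ) (m : ℤ) :
    sturmianCode α (t - m) = sturmianCode α t := by
  simp [sturmianCode]

/-- The coding is locally constant to the right of every point. -/
lemma eventually_sturmianCode_eq_right_s14 (α r : ℝ) :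
    ∀ᶠ t in 𝓝[≥] r, sturmianCode α t = sturmianCode α r := by
  have hr : r ∈ Ico (⌊r⌋ : ℝ) (⌊r⌋ + 1) := ⟨Int.floor_le r, Int.lt_floor_add_one r⟩
  have hlt : ∀ᶠ t : ℝ in 𝓝[≥] r, t < ⌊r⌋ + 1 :=
    mem_nhdsWithin_of_mem_nhds (Iio_mem_nhds hr.2)
  by_cases h : ⌊r⌋ + 1 - α ≤ r
  · filter_upwards [hlt, self_mem_nhdsWithin] with t h₁ (h₂ : r ≤ t)
    rw [sturmianCode_of_mem_Ico hr, sturmianCode_of_mem_Ico ⟨hr.1.trans h₂, h₁⟩]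
    simp [h, h.trans h₂]
  · have hlt' : ∀ᶠ t : ℝ in 𝓝[≥] r, t < ⌊r⌋ + 1 - α :=
      mem_nhdsWithin_of_mem_nhds (Iio_mem_nhds (not_le.1 h))
    filter_upwards [hlt, hlt', self_mem_nhdsWithin] with t h₁ h₃ (h₂ : r ≤ t)
    rw [sturmianCode_of_mem_Ico hr, sturmianCode_of_mem_Ico ⟨hr.1.trans h₂, h₁⟩]
    simp [h, not_le.2 h₃]

/-- The coding is locally constant away from the endpoints of the coding intervals. -/
lemma eventually_sturmianCode_eq_s14 {α r : ℝ} (h₀ : ∀ n : ℤ, r ≠ n) (h₁ : ∀ n : ℤ, r ≠ n - α) :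
    ∀ᶠ t in 𝓝 r, sturmianCode α t = sturmianCode α r := by
  have hr : r ∈ Ioo (⌊r⌋ : ℝ) (⌊r⌋ + 1) :=
    ⟨lt_of_le_of_ne (Int.floor_le r) (h₀ _).symm, Int.lt_floor_add_one r⟩
  have hne : (⌊r⌋ : ℝ) + 1 - α ≠ r := by
    have := h₁ (⌊r⌋ + 1)
    push_cast at this
    exact this.symm
  rcases hne.lt_or_gt with h | h
  · filter_upwards [Ioo_mem_nhds hr.1 hr.2, Ioi_mem_nhds h] with t ht (h₂ : _ < t)
    rw [sturmianCode_of_mem_Ico (Ioo_subset_Ico_self hr),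
      sturmianCode_of_mem_Ico (Ioo_subset_Ico_self ht)]
    simp [h.le, h₂.le]
  · filter_upwards [Ioo_mem_nhds hr.1 hr.2, Iio_mem_nhds h] with t ht (h₂ : t < _)
    rw [sturmianCode_of_mem_Ico (Ioo_subset_Ico_self hr),
      sturmianCode_of_mem_Ico (Ioo_subset_Ico_self ht)]
    simp [not_le.2 h, not_le.2 h₂]

/-- Forward orbits of an irrational rotation are dense modulo `1`. -/
lemma exists_add_nat_mul_sub_int_mem_Ioo {α : ℝ} (hα : Irrational α) (u : ℝ) {a b : ℝ}
    (hab : a < b) : ∃ (i : ℕ) (m : ℤ), u + i * α - m ∈ Ioo a b := by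
  have hd : DenseRange (fun n : ℕ => n • (α : AddCircle (1 : ℝ))) :=
    denseRange_zsmul_iff_nsmul.1 (AddCircle.denseRange_zsmul_coe_iff.2 (by simpa using hα))
  have hopen : IsOpen ((fun r : ℝ => (r : AddCircle (1 : ℝ))) '' Ioo (a - u) (b - u)) :=
    QuotientAddGroup.isOpenMap_coe _ isOpen_Ioo
  obtain ⟨i, r, hr, hri⟩ := hd.exists_mem_open hopen
    ((nonempty_Ioo.2 (by linarith : a - u < b - u)).image _)
  have hri' : ((i * α - r : ℝ) : AddCircle (1 : ℝ)) = 0 := by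
    have : (r : AddCircle (1 : ℝ)) = ((i * α : ℝ) : AddCircle (1 : ℝ)) := by
      rw [← nsmul_eq_mul]
      exact hri
    rw [AddCircle.coe_sub, this, sub_self]
  obtain ⟨m, hm⟩ := (AddCircle.coe_eq_zero_iff (1 : ℝ)).1 hri'
  refine ⟨i, m, ?_⟩
  rw [zsmul_eq_mul, mul_one] at hm
  constructor <;> linarith [hr.1, hr.2]

/-- Agreement of two codings on a long enough prefix forces their base points to be close. -/
lemma exists_prefix_length_forall_close {α : ℝ} (hα : Irrational α) (hm : α ∈ Ioo (0 : ℝ) 1)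
    (u : ℝ) {δ : ℝ} (hδ : 0 < δ) :
    ∃ N : ℕ, ∀ v : ℝ, (∀ i < N, sturmianSeqN α v i = sturmianSeqN α u i) →
      ∃ m : ℤ, |v - m - u| < δ := by
  obtain ⟨hα₀, hα₁⟩ := hm
  obtain ⟨η, hη, hηδ, hηα, hηα'⟩ : ∃ η : ℝ, 0 < η ∧ η ≤ δ ∧ η ≤ α ∧ η ≤ 1 - α :=
    ⟨min δ (min α (1 - α)), by simp [hδ, hα₀, hα₁], min_le_left _ _,
      (min_le_right _ _).trans (min_le_left _ _), (min_le_right _ _).trans (min_le_right _ _)⟩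
  obtain ⟨i₁, m₁, h₁, h₁'⟩ := exists_add_nat_mul_sub_int_mem_Ioo hα u (neg_lt_zero.2 hη)
  obtain ⟨i₂, m₂, h₂, h₂'⟩ := exists_add_nat_mul_sub_int_mem_Ioo hα u hη
  refine ⟨max i₁ i₂ + 1, fun v hv => ?_⟩
  have hv₁ : sturmianCode α (v + i₁ * α) = sturmianCode α (u + i₁ * α) :=
    hv i₁ (Nat.lt_succ_of_le (le_max_left _ _))
  have hv₂ : sturmianCode α (v + i₂ * α) = sturmianCode α (u + i₂ * α) :=
    hv i₂ (Nat.lt_succ_of_le (le_max_right _ _))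
  obtain ⟨k, w, hw₀, hw₁, hvk⟩ : ∃ (k : ℤ) (w : ℝ), 0 ≤ w ∧ w < 1 ∧ v = u + k + w :=
    ⟨⌊v - u⌋, Int.fract (v - u), Int.fract_nonneg _, Int.fract_lt_one _, by
      linarith [Int.floor_add_fract (v - u)]⟩
  by_contra! hfar
  have hwδ : δ ≤ w := by
    have := hfar k
    rwa [show v - k - u = w by linarith, abs_of_nonneg hw₀] at this
  have hwδ' : w ≤ 1 - δ := by
    have := hfar (k + 1)
    push_cast at this
    rw [show v - (k + 1) - u = w - 1 by linarith, abs_of_neg (by linarith)] at this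
    linarith
  rcases le_or_gt w (1 - α) with h | h
  · rw [sturmianCode_eq_true (t := u + i₁ * α) (n := m₁) hα₁ (by linarith) (by linarith),
      sturmianCode_eq_false (n := m₁ + k) hα₀ (by push_cast; linarith)
        (by push_cast; linarith)] at hv₁
    exact Bool.false_ne_true hv₁
  · rw [sturmianCode_eq_false (t := u + i₂ * α) (n := m₂) hα₀ (by linarith) (by linarith),
      sturmianCode_eq_true (n := m₂ + k + 1) hα₁ (by push_cast; linarith)
        (by push_cast; linarith)] at hv₂
    exact Bool.false_ne_true hv₂.symm

/-- An admissible word is an initial block of the coded orbit of a point outside `ℤ + αℤ`. -/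
lemma exists_generic_base_point {α : ℝ} {l n : ℕ} {z : ℕ → Bool} (hz : z ∈ sturmianN α) :
    ∃ s : ℝ, s ∉ ZplusAZ α ∧ ∀ i < l, sturmianSeqN α s i = z (n + i) := by
  obtain ⟨t, ht⟩ := exists_sturmianSeqN_eq_prefix hz (n + l)
  have hev : ∀ᶠ s in 𝓝[≥] (t + n * α), ∀ i ∈ Iio l,
      sturmianCode α (s + i * α) = sturmianCode α (t + n * α + i * α) := by
    refine (eventually_all_finite (finite_Iio l)).2 fun i _ => ?_
    refine Tendsto.eventually ?_ (eventually_sturmianCode_eq_right_s14 α (t + n * α + i * α))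
    refine tendsto_nhdsWithin_iff.2 ⟨?_, ?_⟩
    · exact ((continuous_add_const _).tendsto _).mono_left nhdsWithin_le_nhds
    · filter_upwards [self_mem_nhdsWithin] with s (hs : _ ≤ s)
      exact add_le_add_left hs _
  obtain ⟨c, hc, hsub⟩ := mem_nhdsGE_iff_exists_Ico_subset.1 hev
  have hcount : (ZplusAZ α : Set ℝ).Countable := by
    refine (countable_range fun p : ℤ × ℤ => (p.1 : ℝ) + p.2 * α).mono ?_
    rintro _ ⟨a, b, rfl⟩
    exact ⟨(a, b), rfl⟩
  obtain ⟨s, hsc, hs⟩ := (hcount.dense_compl ℝ).exists_between hc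
  refine ⟨s, hsc, fun i hi => ?_⟩
  rw [← ht (n + i) (by omega)]
  refine (hsub ⟨hs.1.le, hs.2⟩ i hi).trans ?_
  unfold sturmianSeqN
  congr 1
  push_cast
  ring

/-- Around a point outside `ℤ + αℤ` any given initial block of the coding is locally constant. -/
lemma eventually_sturmianSeqN_eq {α s : ℝ} (hs : s ∉ ZplusAZ α) (l : ℕ) :
    ∀ᶠ t in 𝓝 s, ∀ i ∈ Iio l, sturmianSeqN α t i = sturmianSeqN α s i := by
  refine (eventually_all_finite (finite_Iio l)).2 fun i _ => ?_
  refine ((continuous_add_const ((i : ℝ) * α)).tendsto s).eventually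
    (eventually_sturmianCode_eq_s14 ?_ ?_)
  · exact fun n h => hs ⟨n, -i, by push_cast; linarith⟩
  · exact fun n h => hs ⟨n, -i - 1, by push_cast; linarith⟩

/-- Property (∗): For any admissible word `μ` of the one-sided Sturmian
subshift `X_α` there is a point `x ∈ X_α` with `P_{|μ|}(x) = {μ}`. -/
theorem sturmian_property_star (α : ℝ) (hα : Irrational α)
    (hm : α ∈ Set.Ioo (0 : ℝ) 1) (μ : List Bool)
    (hadm : ∃ z ∈ sturmianN α, ∃ n : ℕ,
      ∀ (i : ℕ) (hi : i < μ.length), z (n + i) = μ.get ⟨i, hi⟩) :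
    ∃ x ∈ sturmianN α, past (sturmianN α) μ.length x = {μ} := by
  obtain ⟨z, hz, n, hzμ⟩ := hadm
  obtain ⟨s, hs, hsz⟩ := exists_generic_base_point (l := μ.length) (n := n) hz
  have hsμ : ∀ (i : ℕ) (hi : i < μ.length), sturmianSeqN α s i = μ.get ⟨i, hi⟩ :=
    fun i hi => (hsz i hi).trans (hzμ i hi)
  have hsX : sturmianSeqN α s ∈ sturmianN α := subset_closure ⟨s, rfl⟩
  have hshift (t : ℝ) (i : ℕ) :
      sturmianSeqN α (t + μ.length * α) i = sturmianSeqN α t (i + μ.length) := by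
    unfold sturmianSeqN
    congr 1
    push_cast
    ring
  refine ⟨shiftN^[μ.length] (sturmianSeqN α s),
    shiftN_iterate_mem_of_image (sturmianN_shift_image α) hsX _, ?_⟩
  refine eq_singleton_iff_unique_mem.2 ⟨⟨rfl, ?_⟩, ?_⟩
  · have := wordCat_prefixWord (sturmianSeqN α s) μ.length
    rw [prefixWord_eq_of_get hsμ] at this
    rwa [this]
  · rintro ν ⟨hlen, hν⟩
    obtain ⟨δ, hδ, hball⟩ := Metric.eventually_nhds_iff.1 (eventually_sturmianSeqN_eq hs μ.length)
    obtain ⟨N, hN⟩ := exists_prefix_length_forall_close hα hm (s + μ.length * α) hδ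
    obtain ⟨t, ht⟩ := exists_sturmianSeqN_eq_prefix hν (N + μ.length)
    obtain ⟨m, hclose⟩ := hN (t + μ.length * α) fun i hi => by
      rw [hshift, hshift, ht _ (by omega), ← hlen, wordCat_apply_add_length, hlen,
        shiftN_iterate_apply]
    have hdist : dist (t - m) s < δ := by
      rw [Real.dist_eq]
      convert hclose using 2
      ring
    refine List.ext_get hlen fun i h₁ h₂ => ?_
    rw [← wordCat_apply_of_lt ν _ i h₁, ← hsμ i h₂, ← hball hdist i h₂, ← ht i (by omega)]
    unfold sturmianSeqN
    rw [← sturmianCode_sub_intCast α _ m]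
    congr 1
    ring

end
end
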